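/- Let N ≥ 1, t > 0, and let z ∈ ℝ^N be the strictly increasing vector of the N roots of the physicist's Hermite polynomial H_N. Then for every v ∈ ℝ^N with pairwise distinct coordinates one has F_N(v,t) ≤ 0, with equality if and only if v = √(2t)·ρz for some permutation ρ ∈ S_N. -/

import Mathlib

/-- Physicist's Hermite polynomials: `H 0 = 1`, `H 1 = 2x`,
`H (n+2) = 2x * H (n+1) - 2(n+1) * H n`. -/
noncomputable def physHermite : ℕ → Polynomial ℝ
  | 0 => 1
  | 1 => Polynomial.C 2 * Polynomial.X
  | (n + 2) => Polynomial.C 2 * Polynomial.X * physHermite (n + 1)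
      - Polynomial.C (2 * ((n : ℝ) + 1)) * physHermite n

/-- The function
`F_N(v,t) = (N/2)(N−1)(1 − log t) − ∑_{j=1}^N j log j + 2 log|h_N(v)| − |v|²/(2t)`,
where `h_N(v) = ∏_{i<j} (v_j − v_i)` is the Vandermonde determinant. -/
noncomputable def FN (N : ℕ) (v : Fin N → ℝ) (t : ℝ) : ℝ :=
  ((N : ℝ) / 2) * ((N : ℝ) - 1) * (1 - Real.log t)
    - ∑ j ∈ Finset.Icc 1 N, (j : ℝ) * Real.log j
    + 2 * Real.log |∏ i : Fin N, ∏ j ∈ Finset.Ioi i, (v j - v i)|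
    - (∑ i, v i ^ 2) / (2 * t)

open Polynomial Finset

/-- The off-diagonal sum `∑_{i ≠ j} log |u i - u j|`; the diagonal terms vanish as `log 0 = 0`. -/
noncomputable def logEnergy {ι : Type*} [Fintype ι] (u : ι → ℝ) : ℝ :=
  ∑ i, ∑ j, Real.log |u i - u j|

theorem logEnergy_comp_perm {ι : Type*} [Fintype ι] (u : ι → ℝ) (σ : Equiv.Perm ι) :
    logEnergy (u ∘ σ) = logEnergy u := by
  simp only [logEnergy, Function.comp_apply]
  rw [Equiv.sum_comp σ fun i => ∑ j, Real.log |u i - u (σ j)|]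
  exact sum_congr rfl fun i _ => Equiv.sum_comp σ fun j => Real.log |u i - u j|

theorem sum_sum_ite_ne {ι : Type*} [Fintype ι] [DecidableEq ι] (c : ℝ) :
    ∑ i : ι, ∑ j : ι, (if i = j then 0 else c)
      = Fintype.card ι * ((Fintype.card ι : ℝ) - 1) * c := by
  have h (i j : ι) : (if i = j then 0 else c) = c - if i = j then c else 0 := by
    split_ifs <;> simp
  simp only [h, sum_sub_distrib, sum_ite_eq, mem_univ, if_true, sum_const, card_univ,
    nsmul_eq_mul]
  ring

theorem logEnergy_const_mul {ι : Type*} [Fintype ι] {u : ι → ℝ} (hu : Function.Injective u)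
    {c : ℝ} (hc : 0 < c) :
    logEnergy (fun i => c * u i)
      = Fintype.card ι * ((Fintype.card ι : ℝ) - 1) * Real.log c + logEnergy u := by
  classical
  rw [← sum_sum_ite_ne, logEnergy, logEnergy, ← sum_add_distrib]
  refine sum_congr rfl fun i _ => ?_
  rw [← sum_add_distrib]
  refine sum_congr rfl fun j _ => ?_
  split_ifs with h
  · simp [h]
  · have : u i - u j ≠ 0 := sub_ne_zero.2 (hu.ne h)
    rw [← mul_sub, abs_mul, abs_of_pos hc, Real.log_mul hc.ne' (abs_ne_zero.2 this)]

theorem two_mul_log_abs_prod_prod_Ioi {N : ℕ} {v : Fin N → ℝ} (hv : Function.Injective v) :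
    2 * Real.log |∏ i : Fin N, ∏ j ∈ Ioi i, (v j - v i)| = logEnergy v := by
  have hne {i j : Fin N} (h : j ∈ Ioi i) : |v j - v i| ≠ 0 :=
    abs_ne_zero.2 (sub_ne_zero.2 (hv.ne (mem_Ioi.1 h).ne'))
  simp only [abs_prod]
  rw [Real.log_prod (f := fun i : Fin N => ∏ j ∈ Ioi i, |v j - v i|) fun i _ =>
    prod_ne_zero_iff.2 fun j hj => hne hj]
  have h1 : ∀ i : Fin N, Real.log (∏ j ∈ Ioi i, |v j - v i|)
      = ∑ j ∈ Ioi i, Real.log |v j - v i| := fun i => Real.log_prod fun j hj => hne hj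
  have h2 := sum_sum_Ioi_add_eq_sum_sum_off_diag fun i j => Real.log |v i - v j|
  simp only [abs_sub_comm (v _) (v _), ← two_mul, ← mul_sum] at h2
  have h3 : ∀ i : Fin N, ∑ j ∈ ({i}ᶜ : Finset (Fin N)), Real.log |v j - v i|
      = ∑ j, Real.log |v i - v j| := fun i => by
    rw [← sum_compl_add_sum {i}]
    simp [abs_sub_comm]
  simp only [h1, logEnergy, ← h3]
  simpa [abs_sub_comm] using h2

/-- An antisymmetric double sum is twice the corresponding single-variable sum. -/
theorem sum_sum_sub_mul_inv_sub {ι : Type*} [Fintype ι] (u z : ι → ℝ) :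
    ∑ i, ∑ j, (u i - u j) * (z i - z j)⁻¹ = 2 * ∑ i, u i * ∑ j, (z i - z j)⁻¹ := by
  have h : ∑ i, ∑ j, u j * (z i - z j)⁻¹ = - ∑ i, ∑ j, u i * (z i - z j)⁻¹ := by
    rw [sum_comm, ← sum_neg_distrib]
    refine sum_congr rfl fun i _ => ?_
    rw [← sum_neg_distrib]
    refine sum_congr rfl fun j _ => ?_
    rw [← neg_sub (z i) (z j), inv_neg, mul_neg]
  simp only [sub_mul, sum_sub_distrib, h, mul_sum]
  simp only [← mul_sum]
  ring

/-- The tangent-plane bound for the concave function `logEnergy` on the set of strictly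
increasing vectors. -/
theorem logEnergy_le {ι : Type*} [Fintype ι] [LinearOrder ι] {u z : ι → ℝ}
    (hu : StrictMono u) (hz : StrictMono z) :
    logEnergy u ≤ logEnergy z + 2 * ∑ i, u i * ∑ j, (z i - z j)⁻¹
      - Fintype.card ι * ((Fintype.card ι : ℝ) - 1) := by
  have key : ∀ i j, Real.log |u i - u j| ≤ Real.log |z i - z j| + (u i - u j) * (z i - z j)⁻¹
      - if i = j then 0 else 1 := by
    intro i j
    split_ifs with h
    · simp [h]
    have hpos : 0 < (u i - u j) / (z i - z j) := by
      rcases lt_or_gt_of_ne h with h | h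
      · exact div_pos_of_neg_of_neg (sub_neg.2 (hu h)) (sub_neg.2 (hz h))
      · exact div_pos (sub_pos.2 (hu h)) (sub_pos.2 (hz h))
    have hlog := Real.log_le_sub_one_of_pos hpos
    rw [Real.log_div (sub_ne_zero.2 (hu.injective.ne h)) (sub_ne_zero.2 (hz.injective.ne h)),
      div_eq_mul_inv] at hlog
    rw [Real.log_abs, Real.log_abs]
    linarith
  have := sum_le_sum fun i (_ : i ∈ univ) => sum_le_sum fun j (_ : j ∈ univ) => key i j
  simpa only [sum_sub_distrib, sum_add_distrib, sum_sum_sub_mul_inv_sub, sum_sum_ite_ne, mul_one,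
    logEnergy] using this

theorem sum_sq_of_sum_inv_sub_eq {ι : Type*} [Fintype ι] {z : ι → ℝ}
    (hz : Function.Injective z) (h : ∀ i, ∑ j, (z i - z j)⁻¹ = z i) :
    2 * ∑ i, z i ^ 2 = Fintype.card ι * ((Fintype.card ι : ℝ) - 1) := by
  classical
  have h1 := sum_sum_sub_mul_inv_sub z z
  simp only [h, ← sq] at h1
  rw [← h1, ← mul_one ((Fintype.card ι : ℝ) * _), ← sum_sum_ite_ne]
  refine sum_congr rfl fun i _ => sum_congr rfl fun j _ => ?_
  split_ifs with hij
  · simp [hij]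
  · exact mul_inv_cancel₀ (sub_ne_zero.2 (hz.ne hij))

theorem derivative_physHermite_succ (n : ℕ) :
    derivative (physHermite (n + 1)) = C (2 * ((n : ℝ) + 1)) * physHermite n := by
  induction n using Nat.strong_induction_on with
  | _ n ih =>
    match n with
    | 0 => simp [physHermite]
    | 1 =>
      simp [physHermite]
      ring
    | n + 2 =>
      have h1 := ih (n + 1) (by omega)
      have h2 := ih n (by omega)
      rw [physHermite, derivative_sub, derivative_mul, derivative_mul, derivative_mul, h1, h2]
      simp [physHermite]
      rw [show (C 2 : ℝ[X]) = 2 from map_ofNat C 2]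
      ring

theorem physHermite_succ (n : ℕ) :
    physHermite (n + 1)
      = C 2 * X * physHermite n - derivative (physHermite n) := by
  cases n with
  | zero => simp [physHermite]
  | succ n => rw [physHermite, derivative_physHermite_succ]

theorem physHermite_ode (n : ℕ) :
    derivative (derivative (physHermite n))
      = C 2 * X * derivative (physHermite n) - C (2 * (n : ℝ)) * physHermite n := by
  have h := derivative_physHermite_succ n
  rw [physHermite_succ] at h
  simp only [derivative_sub, derivative_mul, derivative_C, derivative_X] at h
  simp only [C_mul, C_add, C_1] at h ⊢
  linear_combination -h

theorem natDegree_physHermite_le_and_coeff (n : ℕ) :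
    (physHermite n).natDegree ≤ n ∧ (physHermite n).coeff n = 2 ^ n := by
  induction n with
  | zero => simp [physHermite]
  | succ n ih =>
    have hd : (derivative (physHermite n)).natDegree ≤ n :=
      (natDegree_derivative_le _).trans (by omega)
    rw [physHermite_succ, mul_assoc]
    constructor
    · refine (natDegree_sub_le _ _).trans (max_le ?_ (by omega))
      refine (natDegree_C_mul_le _ _).trans (natDegree_mul_le.trans ?_)
      have := natDegree_X_le (R := ℝ)
      omega
    · rw [coeff_sub, coeff_C_mul, coeff_X_mul, ih.2, coeff_eq_zero_of_natDegree_lt (by omega)]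
      ring

theorem natDegree_physHermite (n : ℕ) : (physHermite n).natDegree = n :=
  natDegree_eq_of_le_of_coeff_ne_zero (natDegree_physHermite_le_and_coeff n).1
    (by rw [(natDegree_physHermite_le_and_coeff n).2]; positivity)

theorem leadingCoeff_physHermite (n : ℕ) : (physHermite n).leadingCoeff = 2 ^ n := by
  rw [leadingCoeff, natDegree_physHermite, (natDegree_physHermite_le_and_coeff n).2]

theorem abs_resultant_physHermite_succ (n : ℕ) :
    |resultant (physHermite n) (physHermite (n + 1)) n (n + 1)|
      = ∏ j ∈ Icc 1 n, (8 * (j : ℝ)) ^ j := by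
  induction n with
  | zero => simp [physHermite]
  | succ n ih =>
    have h : physHermite (n + 2) = C (-(2 * ((n : ℝ) + 1))) * physHermite n
        + physHermite (n + 1) * (C 2 * X) := by
      rw [physHermite, C_neg]
      ring
    have hX : (C (2 : ℝ) * X).natDegree ≤ 1 := (natDegree_C_mul_le _ _).trans natDegree_X_le
    rw [h, resultant_add_mul_right _ _ _ _ _ (by omega) (natDegree_physHermite _).le,
      resultant_C_mul_right, show n + 1 + 1 = n + 2 from rfl,
      resultant_add_right_deg _ _ _ _ _ (natDegree_physHermite _).le, resultant_comm,
      (natDegree_physHermite_le_and_coeff _).2, prod_Icc_succ_top (by omega)]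
    simp only [abs_mul, abs_pow, abs_neg, abs_one, one_pow, one_mul, ih]
    rw [abs_of_pos (show (0 : ℝ) < 2 by norm_num),
      abs_of_pos (show (0 : ℝ) < (n : ℝ) + 1 by positivity)]
    push_cast
    rw [show (8 : ℝ) * (n + 1) = 2 * (n + 1) * 2 ^ 2 by ring, mul_pow _ ((2 : ℝ) ^ 2),
      ← pow_mul, ← pow_mul]
    ring

section Roots

variable {N : ℕ} {z : Fin N → ℝ}

theorem roots_physHermite (hz : Function.Injective z)
    (hroot : ∀ i, (physHermite N).eval (z i) = 0) :
    (physHermite N).roots = (univ : Finset (Fin N)).val.map z := by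
  have h0 : physHermite N ≠ 0 := by
    rw [← leadingCoeff_ne_zero, leadingCoeff_physHermite]
    positivity
  symm
  refine Multiset.eq_of_le_of_card_le
    ((Multiset.le_iff_subset (univ.nodup.map hz)).2 fun x hx => ?_) ?_
  · obtain ⟨i, -, rfl⟩ := Multiset.mem_map.1 hx
    exact (mem_roots h0).2 (hroot i)
  · simpa [natDegree_physHermite] using card_roots' (physHermite N)

theorem physHermite_eq_prod (hz : Function.Injective z)
    (hroot : ∀ i, (physHermite N).eval (z i) = 0) :
    physHermite N = C (2 ^ N) * ∏ i, (X - C (z i)) := by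
  have hr := roots_physHermite hz hroot
  have := C_leadingCoeff_mul_prod_multiset_X_sub_C (p := physHermite N)
    (by simp [hr, natDegree_physHermite])
  rw [← this, leadingCoeff_physHermite, hr, Multiset.map_map]
  rfl

theorem eval_derivative_physHermite (hz : Function.Injective z)
    (hroot : ∀ i, (physHermite N).eval (z i) = 0) (i : Fin N) :
    (derivative (physHermite N)).eval (z i) = 2 ^ N * ∏ j ∈ univ.erase i, (z i - z j) := by
  rw [physHermite_eq_prod hz hroot, ← mul_prod_erase univ _ (mem_univ i)]
  simp [eval_prod]

theorem sum_inv_sub_roots_physHermite (hz : Function.Injective z)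
    (hroot : ∀ i, (physHermite N).eval (z i) = 0) (i : Fin N) :
    ∑ j, (z i - z j)⁻¹ = z i := by
  set Q : ℝ[X] := ∏ j ∈ univ.erase i, (X - C (z j)) with hQ
  have hH : physHermite N = C (2 ^ N) * ((X - C (z i)) * Q) := by
    rw [physHermite_eq_prod hz hroot, ← mul_prod_erase univ _ (mem_univ i)]
  have hne : ∀ j ∈ univ.erase i, z i - z j ≠ 0 := fun j hj =>
    sub_ne_zero.2 (hz.ne (ne_of_mem_erase hj).symm)
  have hQi : Q.eval (z i) = ∏ j ∈ univ.erase i, (z i - z j) := by simp [hQ, eval_prod]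
  have hQ0 : Q.eval (z i) ≠ 0 := hQi ▸ prod_ne_zero_iff.2 hne
  have hQ' : (derivative Q).eval (z i) = Q.eval (z i) * ∑ j, (z i - z j)⁻¹ := by
    rw [← add_sum_erase univ _ (mem_univ i), sub_self, inv_zero, zero_add, hQi, mul_sum, hQ,
      derivative_prod_finset, eval_finsetSum]
    refine sum_congr rfl fun j hj => ?_
    rw [← mul_prod_erase (univ.erase i) _ hj]
    have := hne j hj
    simp [eval_prod]
    field_simp
  have hode := congrArg (eval (z i)) (physHermite_ode N)
  rw [eval_sub, eval_mul (p := C (2 * (N : ℝ))), hroot, hH] at hode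
  have hC : derivative ((C 2 : ℝ[X]) ^ N) = 0 := by rw [← C_pow, derivative_C]
  simp [hQ', hC] at hode
  have h2 : (2 : ℝ) ^ N * (2 * Q.eval (z i)) ≠ 0 := by positivity
  refine mul_left_cancel₀ h2 ?_
  linear_combination hode

theorem logEnergy_roots_physHermite (hz : Function.Injective z)
    (hroot : ∀ i, (physHermite N).eval (z i) = 0) :
    logEnergy z = ∑ j ∈ Icc 1 N, (j : ℝ) * Real.log j - N * ((N : ℝ) - 1) / 2 * Real.log 2 := by
  cases N with
  | zero => simp [logEnergy]
  | succ n =>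
    have hsplit : (physHermite (n + 1)).Splits := by
      rw [splits_iff_card_roots, roots_physHermite hz hroot]
      simp [natDegree_physHermite]
    have hres := resultant_eq_prod_eval (physHermite (n + 1)) (physHermite n) n
      (natDegree_physHermite n).le hsplit
    rw [natDegree_physHermite, leadingCoeff_physHermite, roots_physHermite hz hroot,
      Multiset.map_map] at hres
    have hres' := congrArg abs hres
    rw [resultant_comm, abs_mul, abs_resultant_physHermite_succ] at hres'
    change _ = |_ * ∏ i, (physHermite n).eval (z i)| at hres'
    have hder : ∏ i, (2 ^ (n + 1) * ∏ j ∈ univ.erase i, (z i - z j))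
        = (2 * ((n : ℝ) + 1)) ^ (n + 1) * ∏ i, (physHermite n).eval (z i) := by
      simp only [← eval_derivative_physHermite hz hroot, derivative_physHermite_succ, eval_mul,
        eval_C, prod_mul_distrib, prod_const, card_univ, Fintype.card_fin]
      rw [mul_pow]
    have hne : ∀ i, ∏ j ∈ univ.erase i, (z i - z j) ≠ 0 := fun i =>
      prod_ne_zero_iff.2 fun j hj => sub_ne_zero.2 (hz.ne (ne_of_mem_erase hj).symm)
    have hE : ∀ i, Real.log (∏ j ∈ univ.erase i, (z i - z j)) = ∑ j, Real.log |z i - z j| := by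
      intro i
      rw [← add_sum_erase univ _ (mem_univ i), Real.log_prod fun j hj =>
        sub_ne_zero.2 (hz.ne (ne_of_mem_erase hj).symm)]
      simp
    have hP : ∏ i, (physHermite n).eval (z i) ≠ 0 := by
      intro h
      rw [h, mul_zero] at hder
      exact prod_ne_zero_iff.2 (fun i _ => mul_ne_zero (by positivity) (hne i)) hder
    have hlog1 := congrArg Real.log hder
    rw [Real.log_prod fun i _ => mul_ne_zero (by positivity) (hne i),
      Real.log_mul (by positivity) hP, Real.log_pow,
      Real.log_mul two_ne_zero (by positivity)] at hlog1
    simp only [Real.log_mul (pow_ne_zero (n + 1) (two_ne_zero (α := ℝ))) (hne _), hE,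
      sum_add_distrib, Real.log_pow, sum_const, card_univ, Fintype.card_fin,
      nsmul_eq_mul] at hlog1
    have hlog2 := congrArg Real.log hres'
    rw [abs_pow, abs_neg, abs_one, one_pow, one_mul, Real.log_abs,
      Real.log_mul (by positivity) hP, Real.log_prod fun j hj => by
        have : 0 < j := (mem_Icc.1 hj).1
        positivity] at hlog2
    have h8 : ∑ j ∈ Icc 1 n, Real.log ((8 * (j : ℝ)) ^ j)
        = ∑ j ∈ Icc 1 n, (j : ℝ) * Real.log j + 3 * Real.log 2 * ∑ j ∈ Icc 1 n, (j : ℝ) := by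
      rw [mul_sum, ← sum_add_distrib]
      refine sum_congr rfl fun j hj => ?_
      have : 0 < j := (mem_Icc.1 hj).1
      rw [Real.log_pow, Real.log_mul (by norm_num) (by positivity),
        show (8 : ℝ) = 2 ^ 3 by norm_num, Real.log_pow]
      push_cast
      ring
    have hG : ∑ j ∈ Icc 1 n, (j : ℝ) = n * (n + 1) / 2 := by
      clear * -
      induction n with
      | zero => simp
      | succ n ih =>
        rw [sum_Icc_succ_top (by omega), ih]
        push_cast
        ring
    rw [h8, hG] at hlog2
    simp only [Real.log_pow] at hlog2
    rw [logEnergy, sum_Icc_succ_top (by omega)]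
    push_cast at hlog1 hlog2 ⊢
    linear_combination hlog1 - hlog2

end Roots

/-- After rescaling by `√(2t)` the functional no longer depends on `t`. -/
theorem FN_sqrt_mul {N : ℕ} {t : ℝ} (ht : 0 < t) {u : Fin N → ℝ} (hu : Function.Injective u) :
    FN N (fun i => √(2 * t) * u i) t
      = N * ((N : ℝ) - 1) / 2 * (1 + Real.log 2) - ∑ j ∈ Icc 1 N, (j : ℝ) * Real.log j
        + logEnergy u - ∑ i, u i ^ 2 := by
  have h2t : 0 < 2 * t := by positivity
  have hc : 0 < √(2 * t) := Real.sqrt_pos.2 h2t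
  rw [FN, two_mul_log_abs_prod_prod_Ioi fun i j h => hu (mul_left_cancel₀ hc.ne' h),
    logEnergy_const_mul hu hc, Real.log_sqrt h2t.le, Real.log_mul two_ne_zero ht.ne',
    Fintype.card_fin]
  simp only [mul_pow, Real.sq_sqrt h2t.le, ← mul_sum]
  rw [mul_div_cancel_left₀ _ h2t.ne']
  ring


/-- For every `v` with pairwise distinct coordinates, `F_N(v,t) ≤ 0`, with equality
if and only if `v = √(2t)·ρz` for some permutation `ρ`, where `z` is the increasing
vector of roots of the physicist's Hermite polynomial `H_N`. -/
theorem stmt_12 (N : ℕ) (hN : 1 ≤ N) (t : ℝ) (ht : 0 < t)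
    (z : Fin N → ℝ) (hz : StrictMono z)
    (hroot : ∀ i, (physHermite N).eval (z i) = 0)
    (v : Fin N → ℝ) (hv : Function.Injective v) :
    FN N v t ≤ 0
    ∧ (FN N v t = 0
        ↔ ∃ ρ : Equiv.Perm (Fin N), v = fun j => Real.sqrt (2 * t) * z (ρ j)) := by
  have hc : 0 < √(2 * t) := Real.sqrt_pos.2 (by positivity)
  obtain ⟨u, rfl⟩ : ∃ u : Fin N → ℝ, v = fun i => √(2 * t) * u i :=
    ⟨fun i => v i / √(2 * t), funext fun i => (mul_div_cancel₀ _ hc.ne').symm⟩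
  have hu : Function.Injective u := fun i j h => hv (congrArg (√(2 * t) * ·) h)
  have hst := sum_inv_sub_roots_physHermite hz.injective hroot
  have hsq := sum_sq_of_sum_inv_sub_eq hz.injective hst
  have hE := logEnergy_roots_physHermite hz.injective hroot
  rw [Fintype.card_fin] at hsq
  rw [FN_sqrt_mul ht hu]
  set σ := Tuple.sort u
  have hmono : StrictMono (u ∘ σ) :=
    (Tuple.monotone_sort u).strictMono_of_injective (hu.comp σ.injective)
  have hle := logEnergy_le hmono hz
  simp only [logEnergy_comp_perm, hst, Fintype.card_fin, Function.comp_apply] at hle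
  have hdist : ∑ i, (u (σ i) - z i) ^ 2
      = ∑ i, u i ^ 2 - 2 * ∑ i, u (σ i) * z i + ∑ i, z i ^ 2 := by
    rw [← Equiv.sum_comp σ fun i => u i ^ 2, mul_sum, ← sum_sub_distrib, ← sum_add_distrib]
    exact sum_congr rfl fun i _ => by ring
  have hnn : 0 ≤ ∑ i, (u (σ i) - z i) ^ 2 := sum_nonneg fun i _ => sq_nonneg _
  refine ⟨by linarith, fun h => ?_, ?_⟩
  · have h0 : ∑ i, (u (σ i) - z i) ^ 2 = 0 := by linarith
    rw [sum_eq_zero_iff_of_nonneg fun i _ => sq_nonneg _] at h0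
    refine ⟨σ.symm, funext fun j => ?_⟩
    have := sub_eq_zero.1 (pow_eq_zero_iff two_ne_zero |>.1 (h0 (σ.symm j) (mem_univ _)))
    rw [← this, Equiv.apply_symm_apply]
  · rintro ⟨ρ, hρ⟩
    obtain rfl : u = z ∘ ρ := funext fun j => mul_left_cancel₀ hc.ne' (congrFun hρ j)
    have : ∑ i, (z ∘ ρ) i ^ 2 = ∑ i, z i ^ 2 := Equiv.sum_comp ρ fun i => z i ^ 2
    rw [logEnergy_comp_perm, this]
    linarith
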